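/- If a non-trivial equational theory E is finite (i.e., every ≈_E-equivalence class of terms is finite), then E is Noetherian w.r.t. the unrestricted instantiation preorder, i.e., there is no infinite strictly descending chain of substitutions σ₁ >_E^V σ₂ >_E^V σ₃ >_E^V ⋯. -/

import Mathlib

namespace UnifFW

/-- First-order terms over a signature `F` (an arity-indexed family of function
symbols), with variables from the countably infinite set `V = ℕ`. -/
inductive Term (F : ℕ → Type) : Type
  | var : ℕ → Term F
  | app : (n : ℕ) → F n → (Fin n → Term F) → Term F

variable {F : ℕ → Type}

/-- The set of variables occurring in a term. -/
def Term.vars : Term F → Set ℕ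
  | .var x => {x}
  | .app _ _ ts => ⋃ i, (ts i).vars

/-- Homomorphic extension of a map `V → T(Σ,V)` to terms. -/
def Term.subst (σ : ℕ → Term F) : Term F → Term F
  | .var x => σ x
  | .app n f ts => .app n f (fun i => (ts i).subst σ)

/-- The congruence `≈_E` induced by a set `E` of identities: the smallest
equivalence relation containing all substitution instances of identities of `E`
and compatible with the term constructors. -/
inductive EqE (E : Set (Term F × Term F)) : Term F → Term F → Prop
  | ax {s t : Term F} (σ : ℕ → Term F) : (s, t) ∈ E → EqE E (s.subst σ) (t.subst σ)
  | refl (t : Term F) : EqE E t t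
  | symm {s t : Term F} : EqE E s t → EqE E t s
  | trans {s t u : Term F} : EqE E s t → EqE E t u → EqE E s u
  | congr {n : ℕ} (f : F n) {ts us : Fin n → Term F} :
      (∀ i, EqE E (ts i) (us i)) → EqE E (.app n f ts) (.app n f us)

/-- A theory is non-trivial if distinct variables are not equated. -/
def NonTrivial (E : Set (Term F × Term F)) : Prop :=
  ∀ x y : ℕ, x ≠ y → ¬ EqE E (.var x) (.var y)

/-- A theory is regular if both sides of each identity have the same variables. -/
def Regular (E : Set (Term F × Term F)) : Prop :=
  ∀ p ∈ E, (Prod.fst p).vars = (Prod.snd p).vars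

/-- A substitution: a map `V → T(Σ,V)` with finite domain. -/
structure Subst (F : ℕ → Type) where
  toFun : ℕ → Term F
  finite_dom : {x : ℕ | toFun x ≠ Term.var x}.Finite

/-- The domain of a substitution. -/
def Subst.Dom (σ : Subst F) : Set ℕ := {x : ℕ | σ.toFun x ≠ Term.var x}

/-- The variable range of a substitution: all variables occurring in the images
of domain variables. -/
def Subst.VRan (σ : Subst F) : Set ℕ := ⋃ x ∈ σ.Dom, (σ.toFun x).vars

/-- The instantiation preorder `σ ≤_E^X θ`: some substitution `λ` satisfies
`λ(σ(x)) ≈_E θ(x)` for all `x ∈ X`. -/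
def InstLE (E : Set (Term F × Term F)) (X : Set ℕ) (σ θ : Subst F) : Prop :=
  ∃ lam : Subst F, ∀ x ∈ X, EqE E ((σ.toFun x).subst lam.toFun) (θ.toFun x)

/-- The equivalence `σ ∼_E^X θ` induced by the instantiation preorder. -/
def InstEquiv (E : Set (Term F × Term F)) (X : Set ℕ) (σ θ : Subst F) : Prop :=
  InstLE E X σ θ ∧ InstLE E X θ σ

/-- The strict instantiation order `σ <_E^X θ`. -/
def InstLT (E : Set (Term F × Term F)) (X : Set ℕ) (σ θ : Subst F) : Prop :=
  InstLE E X σ θ ∧ ¬ InstLE E X θ σ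

/-- The set of variables occurring in a unification problem. -/
def VarsP (Γ : Set (Term F × Term F)) : Set ℕ :=
  ⋃ p ∈ Γ, (Prod.fst p).vars ∪ (Prod.snd p).vars

/-- `σ` is an `E`-unifier of the unification problem `Γ`. -/
def Unifier (E Γ : Set (Term F × Term F)) (σ : Subst F) : Prop :=
  ∀ p ∈ Γ, EqE E ((Prod.fst p).subst σ.toFun) ((Prod.snd p).subst σ.toFun)

/-- A unification problem is solvable if it has a unifier. -/
def Solvable (E Γ : Set (Term F × Term F)) : Prop := ∃ σ : Subst F, Unifier E Γ σ

/-- `S` is a complete set of `E`-unifiers of `Γ` w.r.t. `≤_E^X`. -/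
def CompleteSet (E Γ : Set (Term F × Term F)) (X : Set ℕ) (S : Set (Subst F)) : Prop :=
  (∀ σ ∈ S, Unifier E Γ σ) ∧ ∀ θ : Subst F, Unifier E Γ θ → ∃ σ ∈ S, InstLE E X σ θ

/-- `S` is a minimal complete set of `E`-unifiers of `Γ` w.r.t. `≤_E^X`:
complete, and no two distinct elements are comparable. -/
def MinimalComplete (E Γ : Set (Term F × Term F)) (X : Set ℕ) (S : Set (Subst F)) : Prop :=
  CompleteSet E Γ X S ∧ ∀ σ ∈ S, ∀ θ ∈ S, σ ≠ θ → ¬ InstLE E X σ θ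

/-- `Γ` has unification type unitary w.r.t. `≤_E^X`. -/
def TypeUnitary (E Γ : Set (Term F × Term F)) (X : Set ℕ) : Prop :=
  ∃ σ : Subst F, MinimalComplete E Γ X {σ}

/-- `Γ` has unification type finitary w.r.t. `≤_E^X`. -/
def TypeFinitary (E Γ : Set (Term F × Term F)) (X : Set ℕ) : Prop :=
  ∃ S : Set (Subst F), MinimalComplete E Γ X S ∧ S.Finite ∧ 1 < S.ncard

/-- `Γ` has unification type infinitary w.r.t. `≤_E^X`. -/
def TypeInfinitary (E Γ : Set (Term F × Term F)) (X : Set ℕ) : Prop :=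
  ∃ S : Set (Subst F), MinimalComplete E Γ X S ∧ S.Infinite

/-- `Γ` has unification type zero w.r.t. `≤_E^X`. -/
def TypeZero (E Γ : Set (Term F × Term F)) (X : Set ℕ) : Prop :=
  ¬ ∃ S : Set (Subst F), MinimalComplete E Γ X S

/-- `σ` is a `≤_E^X`-minimal `E`-unifier of `Γ`. -/
def MinUnifier (E Γ : Set (Term F × Term F)) (X : Set ℕ) (σ : Subst F) : Prop :=
  Unifier E Γ σ ∧ ∀ θ : Subst F, Unifier E Γ θ → InstLE E X θ σ → InstLE E X σ θ

/-- The set `C_E(Γ)` of unifiers all of whose range variables occur in the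
images of at least two distinct variables. -/
def CSet (E Γ : Set (Term F × Term F)) : Set (Subst F) :=
  {σ : Subst F | Unifier E Γ σ ∧
    ∀ y ∈ σ.VRan, ∃ x x' : ℕ, x ≠ x' ∧ y ∈ (σ.toFun x).vars ∩ (σ.toFun x').vars}

/-- `E` is Noetherian w.r.t. the unrestricted instantiation preorder: there is
no infinite strictly descending chain `σ₁ >_E^V σ₂ >_E^V ⋯`. -/
def Noetherian (E : Set (Term F × Term F)) : Prop :=
  ¬ ∃ f : ℕ → Subst F, ∀ n : ℕ, InstLT E Set.univ (f (n + 1)) (f n)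


/-- `E` is a finite theory: every `≈_E`-equivalence class of terms is finite. -/
def FiniteTheory {F : ℕ → Type} (E : Set (Term F × Term F)) : Prop :=
  ∀ t : Term F, {s : Term F | EqE E s t}.Finite

/-! ### Terms -/

theorem Term.finite_vars (t : Term F) : t.vars.Finite := by
  induction t with
  | var x => exact Set.finite_singleton x
  | app n f ts ih => exact Set.finite_iUnion ih

theorem Term.subst_subst (σ τ : ℕ → Term F) (t : Term F) :
    (t.subst σ).subst τ = t.subst fun x => (σ x).subst τ := by
  induction t with
  | var x => rfl
  | app n f ts ih => simp only [Term.subst, ih]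

theorem Term.subst_var (t : Term F) : t.subst Term.var = t := by
  induction t with
  | var x => rfl
  | app n f ts ih => simp only [Term.subst, ih]

theorem Term.subst_congr {σ τ : ℕ → Term F} {t : Term F} (h : ∀ x ∈ t.vars, σ x = τ x) :
    t.subst σ = t.subst τ := by
  induction t with
  | var x => exact h x rfl
  | app n f ts ih =>
    simp only [Term.subst]
    congr 1
    funext i
    exact ih i fun x hx => h x (Set.mem_iUnion.2 ⟨i, hx⟩)

theorem Term.mem_vars_subst {σ : ℕ → Term F} {t : Term F} {x y : ℕ} (hx : x ∈ t.vars)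
    (hy : y ∈ (σ x).vars) : y ∈ (t.subst σ).vars := by
  induction t with
  | var z =>
    obtain rfl : x = z := hx
    exact hy
  | app n f ts ih =>
    obtain ⟨i, hi⟩ := Set.mem_iUnion.1 hx
    exact Set.mem_iUnion.2 ⟨i, ih i hi⟩

/-- The number of symbols of a term. -/
def Term.size : Term F → ℕ
  | .var _ => 1
  | .app _ _ ts => 1 + ∑ i, (ts i).size

theorem Term.size_lt_size_app {n : ℕ} (f : F n) (ts : Fin n → Term F) (i : Fin n) :
    (ts i).size < (Term.app n f ts).size := by
  have h := Finset.single_le_sum (f := fun j => (ts j).size) (fun j _ => Nat.zero_le _)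
    (Finset.mem_univ i)
  simp only [Term.size]
  omega

theorem Term.size_le_size_subst {σ : ℕ → Term F} {t : Term F} {x : ℕ} (hx : x ∈ t.vars) :
    (σ x).size ≤ (t.subst σ).size := by
  induction t with
  | var z =>
    obtain rfl : x = z := hx
    exact le_rfl
  | app n f ts ih =>
    obtain ⟨i, hi⟩ := Set.mem_iUnion.1 hx
    exact (ih i hi).trans (Term.size_lt_size_app f (fun j => (ts j).subst σ) i).le

/-- Over finitely many variables, only finitely many terms have `c` as an instance. -/
theorem Term.finite_generalizations {A : Set ℕ} (hA : A.Finite) (c : Term F) :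
    {t : Term F | t.vars ⊆ A ∧ ∃ σ : ℕ → Term F, t.subst σ = c}.Finite := by
  induction c with
  | var y =>
    refine (hA.image Term.var).subset ?_
    rintro (x | ⟨n, f, ts⟩) ⟨hv, σ, h⟩
    · exact ⟨x, hv rfl, rfl⟩
    · simp [Term.subst] at h
  | app n f ts ih =>
    refine ((hA.image Term.var).union ((Set.Finite.pi' ih).image (Term.app n f))).subset ?_
    rintro (x | ⟨m, g, us⟩) ⟨hv, σ, h⟩
    · exact Or.inl ⟨x, hv rfl, rfl⟩
    · simp only [Term.subst, Term.app.injEq] at h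
      obtain ⟨rfl, hg, hus⟩ := h
      obtain rfl := eq_of_heq hg
      refine Or.inr ⟨us, fun i => ⟨?_, σ, congrFun (eq_of_heq hus) i⟩, rfl⟩
      exact (Set.subset_iUnion (fun j => (us j).vars) i).trans hv

/-! ### The congruence of a theory -/

theorem EqE.subst {E : Set (Term F × Term F)} {s t : Term F} (h : EqE E s t)
    (τ : ℕ → Term F) : EqE E (s.subst τ) (t.subst τ) := by
  induction h with
  | ax σ hst =>
    rw [Term.subst_subst, Term.subst_subst]
    exact EqE.ax _ hst
  | refl t => exact EqE.refl _
  | symm _ ih => exact ih.symm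
  | trans _ _ ih₁ ih₂ => exact ih₁.trans ih₂
  | congr f _ ih => exact EqE.congr f ih

theorem mem_vars_of_eqE_var {E : Set (Term F × Term F)} (hE : NonTrivial E) {t : Term F}
    {x : ℕ} (h : EqE E t (.var x)) : x ∈ t.vars := by
  by_contra hx
  have h' := h.subst fun z => if z = x then .var (x + 1) else .var z
  rw [Term.subst_congr (τ := Term.var), Term.subst_var] at h'
  · simp only [Term.subst, if_true] at h'
    exact hE x (x + 1) (by omega) (h.symm.trans h')
  · intro z hz
    rw [if_neg]
    rintro rfl
    exact hx hz

/-- In a non-trivial finite theory a variable is equivalent only to itself. -/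
theorem eq_var_of_eqE_var {E : Set (Term F × Term F)} (hE : NonTrivial E)
    (hfin : FiniteTheory E) {t : Term F} {x : ℕ} (h : EqE E t (.var x)) : t = .var x := by
  have hx := mem_vars_of_eqE_var hE h
  cases t with
  | var y =>
    obtain rfl : x = y := hx
    rfl
  | app n f ts =>
    obtain ⟨u, hu, hmax⟩ := (hfin (.var x)).exists_maximalFor Term.size _ ⟨_, h⟩
    obtain ⟨i, hi⟩ := Set.mem_iUnion.1 hx
    have hlt : u.size < ((Term.app n f ts).subst fun _ => u).size :=
      (Term.size_le_size_subst (σ := fun _ => u) hi).trans_lt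
        (Term.size_lt_size_app f (fun j => (ts j).subst fun _ => u) i)
    exact absurd (hmax ((h.subst fun _ => u).trans hu) hlt.le) (not_le.2 hlt)

/-! ### Substitutions -/

theorem Subst.toFun_injective : Function.Injective (Subst.toFun : Subst F → ℕ → Term F) := by
  rintro ⟨f, hf⟩ ⟨g, hg⟩ rfl
  rfl

/-- The composition `x ↦ τ (σ x)`. -/
def Subst.comp (τ σ : Subst F) : Subst F where
  toFun x := (σ.toFun x).subst τ.toFun
  finite_dom := by
    refine (σ.finite_dom.union τ.finite_dom).subset fun x hx => ?_
    by_contra h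
    simp only [Set.mem_union, Set.mem_ofPred_eq, not_or, not_not] at h
    exact hx (by rw [h.1]; exact h.2)

/-- The renaming given by a permutation of the variables with finite support. -/
def Subst.ofPerm (e : Equiv.Perm ℕ) (he : {x | e x ≠ x}.Finite) : Subst F where
  toFun x := .var (e x)
  finite_dom := he.subset fun x hx h => hx (by rw [h])

theorem InstLE.trans {E : Set (Term F × Term F)} {X : Set ℕ} {ρ σ θ : Subst F}
    (h₁ : InstLE E X ρ σ) (h₂ : InstLE E X σ θ) : InstLE E X ρ θ := by
  obtain ⟨l₁, h₁⟩ := h₁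
  obtain ⟨l₂, h₂⟩ := h₂
  refine ⟨l₂.comp l₁, fun x hx => ?_⟩
  have h := ((h₁ x hx).subst l₂.toFun).trans (h₂ x hx)
  rwa [Term.subst_subst] at h

/-- A map that is injective off a finite set and the identity almost everywhere agrees off
that set with a permutation of finite support. -/
theorem exists_perm_extending {D S : Set ℕ} (hD : D.Finite) (hS : S.Finite) {g : ℕ → ℕ}
    (hg : Set.InjOn g Dᶜ) (hgS : ∀ x ∉ D, x ∉ S → g x = x) :
    ∃ e : Equiv.Perm ℕ, {x | e x ≠ x}.Finite ∧ ∀ x ∉ D, e x = g x := by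
  classical
  obtain ⟨R, hR⟩ := (hD.union hS).exists_finset_coe
  have hDR : ∀ x, x ∉ R → x ∉ D ∧ x ∉ S := fun x hx => by
    rw [← Finset.mem_coe, hR, Set.mem_union, not_or] at hx
    exact hx
  have hmaps : Set.MapsTo (fun x : R => g x) {x : R | (x : ℕ) ∉ D} R := by
    intro x hx
    by_contra hgx
    obtain ⟨h₁, h₂⟩ := hDR _ hgx
    have hgx' : g x = x := hg h₁ hx (hgS _ h₁ h₂)
    exact hgx (Finset.mem_coe.2 (hgx'.symm ▸ x.2 : g x ∈ R))
  obtain ⟨e, he⟩ := hmaps.exists_equiv_extend_of_card_eq (Fintype.card_coe R)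
    fun x hx y hy hxy => Subtype.ext (hg hx hy hxy)
  refine ⟨Equiv.Perm.ofSubtype (p := (· ∈ R)) e, R.finite_toSet.subset fun x hx => ?_,
    fun x hx => ?_⟩
  · by_contra h
    exact hx (Equiv.Perm.ofSubtype_apply_of_not_mem _ h)
  · by_cases hxR : x ∈ R
    · rw [Equiv.Perm.ofSubtype_apply_of_mem _ hxR]
      exact he ⟨x, hxR⟩ hx
    · rw [Equiv.Perm.ofSubtype_apply_of_not_mem _ hxR]
      obtain ⟨h₁, h₂⟩ := hDR x hxR
      exact (hgS x h₁ h₂).symm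

/-- Every generalization of `σ` is equivalent to one that generalizes `σ` by a map fixing all
variables outside `Dom σ`, and that has itself domain inside `Dom σ`. -/
theorem exists_instEquiv_normal {E : Set (Term F × Term F)} (hE : NonTrivial E)
    (hfin : FiniteTheory E) {σ θ : Subst F} (h : InstLE E Set.univ θ σ) :
    ∃ θ' : Subst F, InstEquiv E Set.univ θ θ' ∧ (∀ x ∉ σ.Dom, θ'.toFun x = .var x) ∧
      ∃ μ : ℕ → Term F, (∀ y ∉ σ.Dom, μ y = .var y) ∧
        ∀ x, EqE E ((θ'.toFun x).subst μ) (σ.toFun x) := by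
  obtain ⟨lam, hlam⟩ := h
  have hvar : ∀ x, ∃ y, x ∉ σ.Dom → θ.toFun x = .var y ∧ lam.toFun y = .var x := by
    intro x
    by_cases hx : x ∈ σ.Dom
    · exact ⟨x, fun h => absurd hx h⟩
    have hl := hlam x trivial
    rw [show σ.toFun x = .var x from not_not.1 hx] at hl
    have hl := eq_var_of_eqE_var hE hfin hl
    cases ht : θ.toFun x with
    | var y =>
      rw [ht] at hl
      exact ⟨y, fun _ => ⟨rfl, hl⟩⟩
    | app n f ts =>
      rw [ht] at hl
      simp [Term.subst] at hl
  choose g hg using hvar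
  have hinj : Set.InjOn g σ.Domᶜ := by
    intro x hx y hy hxy
    have h := (hg x hx).2
    rw [hxy, (hg y hy).2] at h
    exact (Term.var.inj h).symm
  obtain ⟨e, he, heg⟩ := exists_perm_extending σ.finite_dom θ.finite_dom hinj
    fun x hx hx' => Term.var.inj ((hg x hx).1.symm.trans (not_not.1 hx'))
  have he' : {x | e.symm x ≠ x}.Finite :=
    he.subset fun x hx h => hx (e.symm_apply_eq.2 h.symm)
  refine ⟨(Subst.ofPerm e.symm he').comp θ, ⟨⟨Subst.ofPerm e.symm he', fun x _ => EqE.refl _⟩,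
    ⟨Subst.ofPerm e he, fun x _ => ?_⟩⟩, fun x hx => ?_, fun y => lam.toFun (e y),
    fun y hy => ?_, fun x => ?_⟩
  · have : ((θ.toFun x).subst fun y => .var (e.symm y)).subst (fun y => .var (e y)) =
        θ.toFun x := by
      simp [Term.subst_subst, Term.subst, Term.subst_var]
    exact this ▸ EqE.refl _
  · simp [Subst.comp, Subst.ofPerm, (hg x hx).1, Term.subst, ← heg x hx]
  · simp only [heg y hy, (hg y hy).2]
  · simpa [Subst.comp, Subst.ofPerm, Term.subst_subst, Term.subst] using hlam x trivial

/-- In a finite theory, a substitution has only finitely many normalized generalizations. -/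
theorem finite_normal_generalizations {E : Set (Term F × Term F)} (hfin : FiniteTheory E)
    (σ : Subst F) :
    {θ : Subst F | (∀ x ∉ σ.Dom, θ.toFun x = .var x) ∧
      ∃ μ : ℕ → Term F, (∀ y ∉ σ.Dom, μ y = .var y) ∧
        ∀ x, EqE E ((θ.toFun x).subst μ) (σ.toFun x)}.Finite := by
  have hDom : σ.Dom.Finite := σ.finite_dom
  let C : ℕ → Set (Term F) := fun x => {s | EqE E s (σ.toFun x)}
  let A : ℕ → Set ℕ := fun x => σ.Dom ∪ ⋃ c ∈ C x, c.vars
  have hA : ∀ x, (A x).Finite := fun x =>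
    hDom.union ((hfin _).biUnion fun c _ => c.finite_vars)
  let T : ℕ → Set (Term F) := fun x =>
    ⋃ c ∈ C x, {t | t.vars ⊆ A x ∧ ∃ μ : ℕ → Term F, t.subst μ = c}
  have hT : ∀ x, (T x).Finite := fun x =>
    (hfin _).biUnion fun c _ => Term.finite_generalizations (hA x) c
  have : Finite σ.Dom := hDom
  refine Set.Finite.of_finite_image (f := fun θ (x : σ.Dom) => θ.toFun x)
    ((Set.Finite.pi' fun x : σ.Dom => hT x).subset ?_) ?_
  · rintro _ ⟨θ, ⟨-, μ, hμ, hθ⟩, rfl⟩ x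
    refine Set.mem_biUnion (hθ x) ⟨fun y hy => ?_, μ, rfl⟩
    by_cases hyD : y ∈ σ.Dom
    · exact Or.inl hyD
    · exact Or.inr (Set.mem_biUnion (hθ x)
        (Term.mem_vars_subst hy (by rw [hμ y hyD]; rfl)))
  · rintro θ ⟨hθ, -⟩ θ' ⟨hθ', -⟩ h
    refine Subst.toFun_injective (funext fun x => ?_)
    by_cases hx : x ∈ σ.Dom
    · exact congrFun h ⟨x, hx⟩
    · rw [hθ x hx, hθ' x hx]

/-- Lemma `finite:implies:noetherian:lem`: every non-trivial
finite equational theory is Noetherian w.r.t. the unrestricted instantiation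
preorder. -/
theorem stmt12 {F : ℕ → Type} (E : Set (Term F × Term F)) (hE : NonTrivial E)
    (hfin : FiniteTheory E) : Noetherian E := by
  rintro ⟨f, hf⟩
  have hle : ∀ n k, InstLE E Set.univ (f (n + k)) (f n) := by
    intro n k
    induction k with
    | zero => exact ⟨⟨Term.var, by simp⟩, fun x _ => by rw [Term.subst_var]; exact EqE.refl _⟩
    | succ k ih => exact (hf (n + k)).1.trans ih
  choose θ hequiv hnormal using fun n =>
    exists_instEquiv_normal hE hfin (Nat.zero_add n ▸ hle 0 n)
  obtain ⟨m, n, hmn, heq⟩ :=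
    (finite_normal_generalizations hfin (f 0)).exists_lt_map_eq_of_forall_mem hnormal
  obtain ⟨k, rfl⟩ := Nat.exists_eq_add_of_le (Nat.succ_le_of_lt hmn)
  have hback := (hequiv (m + 1 + k)).2
  rw [← heq] at hback
  exact (hf m).2 (((hequiv m).1.trans hback).trans (hle (m + 1) k))
end UnifFW
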